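/- The map T maps A_n into A_n, and for every a ∈ A_n one has area(T(a)) = dinv(a) and bounce-sum equal to area: ∑_{j=0}^{n−1} b_j = area(a), where b = sort(a) is the bounce vector of T(a). In particular, (area × bounce) ∘ T = dinv × area as maps A_n → ℝ². -/

import Mathlib

open MeasureTheory Finset Filter

noncomputable section

/-- `sc x = max (1 - |x|) 0`. -/
def sc (x : ℝ) : ℝ := max (1 - |x|) 0

/-- Extend `a : Fin k → ℝ` (thought of as coordinates `a_1, …, a_k`) to an ℕ-indexed
vector with the convention `a_0 = 0` (and value `0` beyond index `k`). -/
def cext {k : ℕ} (a : Fin k → ℝ) (i : ℕ) : ℝ :=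
  if h : 1 ≤ i ∧ i ≤ k then a ⟨i - 1, by omega⟩ else 0

/-- The area polytope `A_n ⊆ ℝ^{n-1}`. -/
def areaPoly (n : ℕ) : Set (Fin (n - 1) → ℝ) :=
  {a | ∀ i < n - 1, 0 ≤ cext a (i + 1) ∧ cext a (i + 1) ≤ cext a i + 1}

/-- The bounce polytope `B_n ⊆ ℝ^{n-1}`. -/
def bouncePoly (n : ℕ) : Set (Fin (n - 1) → ℝ) :=
  {b | ∀ i < n - 1, cext b i ≤ cext b (i + 1) ∧ cext b (i + 1) ≤ cext b i + 1}

/-- `area(a) = ∑_{i=0}^{n-1} a_i`. -/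
def area (n : ℕ) (a : Fin (n - 1) → ℝ) : ℝ := ∑ i ∈ Finset.range n, cext a i

/-- `dinv(a) = ∑_{0 ≤ i < j ≤ n-1} sc(a_i - a_j)`. -/
def dinv (n : ℕ) (a : Fin (n - 1) → ℝ) : ℝ :=
  ∑ j ∈ Finset.range n, ∑ i ∈ Finset.range j, sc (cext a i - cext a j)

/-- The `q,t`-Catalan measure `μ_n`: pushforward of Lebesgue measure restricted to `A_n`
under `a ↦ (dinv a, area a)`. -/
def qtMeasure (n : ℕ) : Measure (ℝ × ℝ) :=
  Measure.map (fun a => (dinv n a, area n a)) (volume.restrict (areaPoly n))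

/-- The map `f` sending a bounce vector to the area vector of the same continuous
Dyck path: `f(b)_j = ∑_{i=0}^{j-1} sc(b_j - b_i)` for `j = 1, …, n-1` (with `b_0 = 0`). -/
def fmap (n : ℕ) (b : Fin (n - 1) → ℝ) : Fin (n - 1) → ℝ :=
  fun j => ∑ i ∈ Finset.range (j.1 + 1), sc (cext b (j.1 + 1) - cext b i)

/-- The nondecreasing rearrangement of `a`. -/
def sortVec (n : ℕ) (a : Fin (n - 1) → ℝ) : Fin (n - 1) → ℝ := a ∘ Tuple.sort a

/-- The map `T : a ↦ f(sort(a))`, sending (the area vector of) a path to (the area vector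
of) the path whose bounce vector is the sorted area vector of the original path. -/
def Tmap (n : ℕ) (a : Fin (n - 1) → ℝ) : Fin (n - 1) → ℝ := fmap n (sortVec n a)

theorem cext_zero' {k : ℕ} (a : Fin k → ℝ) : cext a 0 = 0 := by simp [cext]

theorem cext_succ' {k : ℕ} (a : Fin k → ℝ) (i : ℕ) (h : i < k) : cext a (i + 1) = a ⟨i, h⟩ := by
  have : 1 ≤ i + 1 ∧ i + 1 ≤ k := by omega
  simp [cext, this]

theorem sum_cext {k : ℕ} (a : Fin k → ℝ) (F : ℝ → ℝ) :
    ∑ i ∈ Finset.range (k + 1), F (cext a i) = F 0 + ∑ i, F (a i) := by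
  rw [Finset.sum_range_succ', cext_zero', add_comm, Finset.sum_range]
  congr 1
  exact Finset.sum_congr rfl fun i _ => by rw [cext_succ' a i.1 i.2]

theorem sum_cext_perm {k : ℕ} (a : Fin k → ℝ) (σ : Equiv.Perm (Fin k)) (F : ℝ → ℝ) :
    ∑ i ∈ Finset.range (k + 1), F (cext (a ∘ σ) i) = ∑ i ∈ Finset.range (k + 1), F (cext a i) := by
  rw [sum_cext, sum_cext]
  congr 1
  exact Equiv.sum_comp σ (fun i => F (a i))

theorem sc_neg' (x : ℝ) : sc (-x) = sc x := by simp [sc]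

theorem double_sum (g : ℕ → ℝ) (N : ℕ) :
    ∑ j ∈ Finset.range N, ∑ i ∈ Finset.range N, sc (g i - g j) =
      2 * (∑ j ∈ Finset.range N, ∑ i ∈ Finset.range j, sc (g i - g j)) + N := by
  induction N with
  | zero => simp
  | succ N ih =>
    have h : ∑ j ∈ Finset.range N, sc (g N - g j) = ∑ j ∈ Finset.range N, sc (g j - g N) :=
      Finset.sum_congr rfl fun j _ => by rw [← sc_neg', neg_sub]
    have h0 : sc (g N - g N) = 1 := by simp [sc]
    simp only [Finset.sum_range_succ, Finset.sum_add_distrib, ih, h, h0]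
    push_cast
    ring

theorem dinv_perm {k : ℕ} (a : Fin k → ℝ) (σ : Equiv.Perm (Fin k)) :
    dinv (k + 1) (a ∘ σ) = dinv (k + 1) a := by
  have h1 := double_sum (cext a) (k + 1)
  have h2 := double_sum (cext (a ∘ σ)) (k + 1)
  have h3 : ∑ j ∈ Finset.range (k + 1), ∑ i ∈ Finset.range (k + 1),
      sc (cext (a ∘ σ) i - cext (a ∘ σ) j) =
      ∑ j ∈ Finset.range (k + 1), ∑ i ∈ Finset.range (k + 1), sc (cext a i - cext a j) := by
    rw [← sum_cext_perm a σ (fun y => ∑ i ∈ Finset.range (k + 1), sc (cext a i - y))]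
    exact Finset.sum_congr rfl fun j _ =>
      sum_cext_perm a σ (fun x => sc (x - cext (a ∘ σ) j))
  have e1 : dinv (k + 1) (a ∘ σ) = ∑ j ∈ Finset.range (k + 1), ∑ i ∈ Finset.range j,
      sc (cext (a ∘ σ) i - cext (a ∘ σ) j) := rfl
  have e2 : dinv (k + 1) a = ∑ j ∈ Finset.range (k + 1), ∑ i ∈ Finset.range j,
      sc (cext a i - cext a j) := rfl
  rw [e1, e2]
  linarith

theorem cext_fmap {k : ℕ} (b : Fin k → ℝ) (j : ℕ) (hj : j < k + 1) :
    cext (k := k) (fmap (k + 1) b) j = ∑ i ∈ Finset.range j, sc (cext b j - cext b i) := by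
  cases j with
  | zero => simp [cext_zero']
  | succ j => rw [cext_succ' _ j (by omega)]; rfl

theorem sc_nonneg' (x : ℝ) : 0 ≤ sc x := le_max_right _ _

theorem sc_le_one' (x : ℝ) : sc x ≤ 1 := by
  unfold sc
  exact max_le (by linarith [abs_nonneg x]) zero_le_one

theorem sc_anti {x y : ℝ} (hx : 0 ≤ x) (h : x ≤ y) : sc y ≤ sc x := by
  unfold sc
  rw [abs_of_nonneg hx, abs_of_nonneg (hx.trans h)]
  exact max_le_max (by linarith) le_rfl

theorem cext_mono {k : ℕ} (b : Fin k → ℝ) (hb : Monotone b) (h0 : ∀ i, 0 ≤ b i) {i j : ℕ}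
    (hij : i ≤ j) (hj : j ≤ k) : cext b i ≤ cext b j := by
  cases j with
  | zero => obtain rfl : i = 0 := by omega
            exact le_rfl
  | succ j =>
    rw [cext_succ' b j (by omega)]
    cases i with
    | zero => rw [cext_zero']; exact h0 _
    | succ i =>
      rw [cext_succ' b i (by omega)]
      exact hb (by simp only [Fin.mk_le_mk]; omega)

theorem Tmap_aux (k : ℕ) (a : Fin k → ℝ) (ha : a ∈ areaPoly (k + 1)) :
      Tmap (k + 1) a ∈ areaPoly (k + 1) ∧
      area (k + 1) (Tmap (k + 1) a) = dinv (k + 1) a ∧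
      (∑ j : Fin k, sortVec (k + 1) a j) = area (k + 1) a := by
  have hb : Monotone (a ∘ Tuple.sort a) := Tuple.monotone_sort a
  have h0 : ∀ i, 0 ≤ (a ∘ Tuple.sort a) i := by
    intro i
    have := (ha (Tuple.sort a i).1 (Tuple.sort a i).2).1
    have e : cext (k := k) a ((Tuple.sort a i).1 + 1) = a (Tuple.sort a i) :=
      cext_succ' a _ (Tuple.sort a i).2
    exact this.trans_eq e
  refine ⟨?_, ?_, ?_⟩
  · intro j hj
    have hj : j < k := hj
    change 0 ≤ cext (k := k) (fmap (k + 1) (a ∘ Tuple.sort a)) (j + 1) ∧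
      cext (k := k) (fmap (k + 1) (a ∘ Tuple.sort a)) (j + 1) ≤
        cext (k := k) (fmap (k + 1) (a ∘ Tuple.sort a)) j + 1
    rw [cext_fmap _ _ (by omega), cext_fmap _ _ (by omega)]
    refine ⟨Finset.sum_nonneg fun i _ => sc_nonneg' _, ?_⟩
    rw [Finset.sum_range_succ]
    refine add_le_add (Finset.sum_le_sum fun i hi => ?_) (sc_le_one' _)
    have hi := Finset.mem_range.1 hi
    have h1 := cext_mono _ hb h0 (i := i) (j := j) hi.le hj.le
    have h2 := cext_mono _ hb h0 (i := j) (j := j + 1) (by omega) hj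
    exact sc_anti (by linarith) (by linarith)
  · rw [← dinv_perm a (Tuple.sort a)]
    refine Finset.sum_congr rfl fun j hj => ?_
    refine (cext_fmap (a ∘ Tuple.sort a) j (Finset.mem_range.1 hj)).trans ?_
    exact Finset.sum_congr rfl fun i _ => by rw [← sc_neg', neg_sub]
  · have h := sum_cext a id
    simp only [id, zero_add] at h
    exact (Equiv.sum_comp (Tuple.sort a) a).trans h.symm

/-- `T` maps `A_n` into `A_n`, and `area(T(a)) = dinv(a)` while the bounce statistic of
`T(a)` (the sum of the coordinates of its bounce vector `sort(a)`) equals `area(a)`. -/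
theorem Tmap_stats (n : ℕ) (hn : 2 ≤ n) :
    ∀ a ∈ areaPoly n,
      Tmap n a ∈ areaPoly n ∧
      area n (Tmap n a) = dinv n a ∧
      (∑ j : Fin (n - 1), sortVec n a j) = area n a := by
  obtain ⟨k, rfl⟩ : ∃ k, n = k + 1 := ⟨n - 1, by omega⟩
  exact fun a ha => Tmap_aux k a ha
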